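/- (Mikulás' theorem, obtained here as a corollary.) If a sequent in the language of \, /, ·, ∧ (without constants 0 and 1) is true in every square R-model, then it is derivable in L^Λ(∧), the fragment of L^Λ(∧,0,1) obtained by dropping the axioms and rules for 0 and 1. -/

import Mathlib

/-- Formulae of the Lambek calculus with intersection (no constants). -/
inductive Fm where
  | var : ℕ → Fm                -- propositional variable
  | mul : Fm → Fm → Fm          -- product A·B
  | ldiv : Fm → Fm → Fm         -- left division A\B
  | rdiv : Fm → Fm → Fm         -- right division B/A
  | inter : Fm → Fm → Fm        -- intersection A∧B

/-- Derivability of sequents in `L^Λ(∧)` (no hypotheses, no constants). -/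
inductive Deriv : List Fm → Fm → Prop
  | id (A) : Deriv [A] A
  | cut {P A Γ Δ C} : Deriv P A → Deriv (Γ ++ [A] ++ Δ) C →
      Deriv (Γ ++ P ++ Δ) C
  | ldivL {P A Γ B Δ C} : Deriv P A → Deriv (Γ ++ [B] ++ Δ) C →
      Deriv (Γ ++ P ++ [Fm.ldiv A B] ++ Δ) C
  | ldivR {P A B} : Deriv (A :: P) B → Deriv P (Fm.ldiv A B)
  | rdivL {P A Γ B Δ C} : Deriv P A → Deriv (Γ ++ [B] ++ Δ) C →
      Deriv (Γ ++ [Fm.rdiv B A] ++ P ++ Δ) C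
  | rdivR {P A B} : Deriv (P ++ [A]) B → Deriv P (Fm.rdiv B A)
  | mulL {Γ A B Δ C} : Deriv (Γ ++ [A, B] ++ Δ) C →
      Deriv (Γ ++ [Fm.mul A B] ++ Δ) C
  | mulR {P A Δ B} : Deriv P A → Deriv Δ B → Deriv (P ++ Δ) (Fm.mul A B)
  | andL1 {Γ A B Δ C} : Deriv (Γ ++ [A] ++ Δ) C →
      Deriv (Γ ++ [Fm.inter A B] ++ Δ) C
  | andL2 {Γ A B Δ C} : Deriv (Γ ++ [B] ++ Δ) C →
      Deriv (Γ ++ [Fm.inter A B] ++ Δ) C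
  | andR {P A B} : Deriv P A → Deriv P B → Deriv P (Fm.inter A B)

/-- Relational composition of binary relations on `W`. -/
def rcomp {W : Type} (R S : Set (W × W)) : Set (W × W) :=
  {p | ∃ y, (p.1, y) ∈ R ∧ (y, p.2) ∈ S}

/-- Left residual `R \ S`. -/
def lres {W : Type} (R S : Set (W × W)) : Set (W × W) :=
  {p | ∀ x, (x, p.1) ∈ R → (x, p.2) ∈ S}

/-- Right residual `S / R`. -/
def rres {W : Type} (S R : Set (W × W)) : Set (W × W) :=
  {p | ∀ z, (p.2, z) ∈ R → (p.1, z) ∈ S}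

/-- The diagonal relation `δ`. -/
def diag {W : Type} : Set (W × W) := {p | p.1 = p.2}

/-- A square R-model over a (non-empty) set `W`. -/
structure SqModel (W : Type) where
  v : Fm → Set (W × W)
  v_mul : ∀ A B, v (Fm.mul A B) = rcomp (v A) (v B)
  v_ldiv : ∀ A B, v (Fm.ldiv A B) = lres (v A) (v B)
  v_rdiv : ∀ B A, v (Fm.rdiv B A) = rres (v B) (v A)
  v_inter : ∀ A B, v (Fm.inter A B) = v A ∩ v B

/-- Interpretation of an antecedent: `v(A₁)∘…∘v(Aₙ)`, with `δ` for the empty list. -/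
def SqModel.vList {W : Type} (M : SqModel W) : List Fm → Set (W × W)
  | [] => diag
  | A :: Γ => rcomp (M.v A) (M.vList Γ)

/-- Truth of a sequent in a square R-model. -/
def SqModel.seqTrue {W : Type} (M : SqModel W) (s : List Fm × Fm) : Prop :=
  M.vList s.1 ⊆ M.v s.2

namespace Fm

/-- An injective numbering of formulae. -/
def code : Fm → ℕ
  | var n => Nat.pair 0 n
  | mul A B => Nat.pair 1 (Nat.pair A.code B.code)
  | ldiv A B => Nat.pair 2 (Nat.pair A.code B.code)
  | rdiv A B => Nat.pair 3 (Nat.pair A.code B.code)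
  | inter A B => Nat.pair 4 (Nat.pair A.code B.code)

theorem code_injective : Function.Injective code := by
  intro A
  induction A <;> intro B h <;> cases B <;> simp_all [code, Nat.pair_eq_pair] <;>
    grind [Function.Injective]

instance : Countable Fm := code_injective.countable

/-- The slash predicate: a formula is slashed if it is a theorem and, hereditarily, its
components behave accordingly (a product has both factors slashed, a division maps slashed
formulae to slashed formulae). -/
def Slash : Fm → Prop
  | var n => Deriv [] (var n)
  | mul A B => A.Slash ∧ B.Slash
  | ldiv A B => Deriv [] (ldiv A B) ∧ (A.Slash → B.Slash)
  | rdiv B A => Deriv [] (rdiv B A) ∧ (A.Slash → B.Slash)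
  | inter A B => A.Slash ∧ B.Slash

theorem Slash.deriv {A : Fm} (h : A.Slash) : Deriv [] A := by
  induction A with
  | var n => exact h
  | mul A B ihA ihB => exact Deriv.mulR (ihA h.1) (ihB h.2)
  | ldiv A B => exact h.1
  | rdiv B A => exact h.1
  | inter A B ihA ihB => exact Deriv.andR (ihA h.1) (ihB h.2)

end Fm

namespace Deriv

theorem of_slash {Γ Δ : List Fm} {C : Fm} (hΔ : ∀ A ∈ Δ, A.Slash) (h : Deriv (Δ ++ Γ) C) :
    Deriv Γ C := by
  induction Δ with
  | nil => exact h
  | cons A Δ ih =>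
    exact ih (fun B hB => hΔ B (by simp [hB]))
      (Deriv.cut (P := []) (Γ := []) (hΔ A (by simp)).deriv h)

theorem slash {Γ : List Fm} {C : Fm} (h : Deriv Γ C) (hΓ : ∀ A ∈ Γ, A.Slash) : C.Slash := by
  induction h with
  | ldivR h ih =>
    exact ⟨of_slash hΓ (by simpa using Deriv.ldivR h), fun hA => ih (by simp_all)⟩
  | rdivR h ih =>
    refine ⟨of_slash hΓ (by simpa using Deriv.rdivR h), fun hA => ih ?_⟩
    simp_all [or_imp]
  | _ => simp_all [or_imp, forall_and, Fm.Slash]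

theorem of_nil_mul {A B : Fm} (h : Deriv [] (Fm.mul A B)) : Deriv [] A ∧ Deriv [] B :=
  have hs : (Fm.mul A B).Slash := h.slash (by simp)
  ⟨hs.1.deriv, hs.2.deriv⟩

theorem ldiv_app {Γ Δ : List Fm} {A B : Fm} (hA : Deriv Γ A) (h : Deriv Δ (Fm.ldiv A B)) :
    Deriv (Γ ++ Δ) B := by
  simpa using Deriv.cut (Δ := []) h (Deriv.ldivL (Γ := []) (Δ := []) hA (Deriv.id B))

theorem rdiv_app {Γ Δ : List Fm} {A B : Fm} (h : Deriv Γ (Fm.rdiv B A)) (hA : Deriv Δ A) :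
    Deriv (Γ ++ Δ) B := by
  have h' := Deriv.rdivL (Γ := []) (Δ := []) hA (Deriv.id B)
  simpa using Deriv.cut (Γ := []) h (by simpa using h')

theorem inter_left {Γ : List Fm} {A B : Fm} (h : Deriv Γ (Fm.inter A B)) : Deriv Γ A := by
  simpa using Deriv.cut (Γ := []) (Δ := []) h
    (Deriv.andL1 (Γ := []) (Δ := []) (Deriv.id A))

theorem inter_right {Γ : List Fm} {A B : Fm} (h : Deriv Γ (Fm.inter A B)) : Deriv Γ B := by
  simpa using Deriv.cut (Γ := []) (Δ := []) h
    (Deriv.andL2 (Γ := []) (Δ := []) (Deriv.id B))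

end Deriv

/-- `Δ` may be replaced by `Γ` in every antecedent. -/
def Refines (Γ Δ : List Fm) : Prop :=
  ∀ Θ₁ Θ₂ C, Deriv (Θ₁ ++ Δ ++ Θ₂) C → Deriv (Θ₁ ++ Γ ++ Θ₂) C

namespace Refines

theorem rfl {Γ : List Fm} : Refines Γ Γ := fun _ _ _ h => h

theorem trans {Γ Δ Θ : List Fm} (h₁ : Refines Γ Δ) (h₂ : Refines Δ Θ) : Refines Γ Θ :=
  fun _ _ _ h => h₁ _ _ _ (h₂ _ _ _ h)

theorem append_left {Γ Δ : List Fm} (Θ : List Fm) (h : Refines Γ Δ) :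
    Refines (Θ ++ Γ) (Θ ++ Δ) := fun Θ₁ Θ₂ C hC => by
  simpa using h (Θ₁ ++ Θ) Θ₂ C (by simpa using hC)

theorem append_right {Γ Δ : List Fm} (Θ : List Fm) (h : Refines Γ Δ) :
    Refines (Γ ++ Θ) (Δ ++ Θ) := fun Θ₁ Θ₂ C hC => by
  simpa using h Θ₁ (Θ ++ Θ₂) C (by simpa using hC)

theorem deriv {Γ Δ : List Fm} {C : Fm} (h : Refines Γ Δ) (hC : Deriv Δ C) : Deriv Γ C := by
  simpa using h [] [] C (by simpa using hC)

theorem of_deriv_mul {Γ : List Fm} {A B : Fm} (h : Deriv Γ (Fm.mul A B)) :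
    Refines Γ [A, B] := fun _ _ _ hC => h.cut (Deriv.mulL hC)

end Refines

/-- A labelled graph on `ℕ`: `L u w Γ` says that there is an edge from `u` to `w` with
label `Γ`. -/
abbrev LabelledGraph := ℕ → ℕ → List Fm → Prop

/-- A network on a set of points: a partial order whose edges are uniquely labelled, with the
empty label on loops, such that the label of a composite edge refines the concatenation
of the labels. -/
structure IsNetwork (S : Set ℕ) (L : LabelledGraph) : Prop where
  left_mem : ∀ {u w Γ}, L u w Γ → u ∈ S
  right_mem : ∀ {u w Γ}, L u w Γ → w ∈ S
  refl : ∀ {u}, u ∈ S → L u u []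
  label_unique : ∀ {u w Γ Δ}, L u w Γ → L u w Δ → Γ = Δ
  antisymm : ∀ {u w Γ Δ}, L u w Γ → L w u Δ → u = w
  trans : ∀ {u v w Γ Δ}, L u v Γ → L v w Δ → ∃ Θ, L u w Θ ∧ Refines Θ (Γ ++ Δ)

/-- A request for a new point. The first component `(y, B)` asks for an edge labelled `B` from
the new point to `y`, the second component `(x, A)` for an edge labelled `A` from `x` to the
new point. -/
abbrev Request := Option (ℕ × Fm) × Option (ℕ × Fm)

/-- A request to insert a point between `x` and `y` is admissible if there is a proper edge
from `x` to `y` whose label derives the product of the requested labels. -/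
def Request.Admissible (L : LabelledGraph) (r : Request) : Prop :=
  ∀ x A y B, r.1 = some (y, B) → r.2 = some (x, A) →
    x ≠ y ∧ ∃ Θ, L x y Θ ∧ Deriv Θ (Fm.mul A B)

/-- Extension of a labelled graph by a new point `n` answering the request `r`; the point is
isolated if `r` is not admissible. -/
inductive Extend (L : LabelledGraph) (n : ℕ) (r : Request) : LabelledGraph
  | old {u w Γ} : L u w Γ → Extend L n r u w Γ
  | refl : Extend L n r n n []
  | up {y B w Γ} : r.Admissible L → r.1 = some (y, B) → L y w Γ → Extend L n r n w (B :: Γ)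
  | down {x A u Γ} : r.Admissible L → r.2 = some (x, A) → L u x Γ →
      Extend L n r u n (Γ ++ [A])

theorem IsNetwork.extend {L : LabelledGraph} {n : ℕ} (h : IsNetwork (Set.Iio n) L)
    (r : Request) : IsNetwork (Set.Iio (n + 1)) (Extend L n r) := by
  have hl : ∀ {w Γ}, ¬ L n w Γ := fun e => lt_irrefl n (h.left_mem e)
  have hr : ∀ {u Γ}, ¬ L u n Γ := fun e => lt_irrefl n (h.right_mem e)
  have hcycle : ∀ {x A y B w Γ Δ}, r.Admissible L → r.1 = some (y, B) → r.2 = some (x, A) →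
      L y w Γ → ¬ L w x Δ := by
    intro x A y B w Γ Δ ok h₁ h₂ e₁ e₂
    obtain ⟨hne, Θ, e, -⟩ := ok x A y B h₁ h₂
    obtain ⟨_, e', -⟩ := h.trans e₁ e₂
    exact hne (h.antisymm e e')
  refine ⟨?_, ?_, ?_, ?_, ?_, ?_⟩
  · rintro u w Γ (e | _ | ⟨_, _, _⟩ | ⟨_, _, e⟩)
    · exact Nat.lt_succ_of_lt (h.left_mem e)
    · exact Nat.lt_succ_self n
    · exact Nat.lt_succ_self n
    · exact Nat.lt_succ_of_lt (h.left_mem e)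
  · rintro u w Γ (e | _ | ⟨_, _, e⟩ | ⟨_, _, _⟩)
    · exact Nat.lt_succ_of_lt (h.right_mem e)
    · exact Nat.lt_succ_self n
    · exact Nat.lt_succ_of_lt (h.right_mem e)
    · exact Nat.lt_succ_self n
  · intro u hu
    rcases Nat.lt_succ_iff_lt_or_eq.1 hu with hu | rfl
    · exact .old (h.refl hu)
    · exact .refl
  · rintro u w Γ Δ (e | _ | ⟨_, h₁, e⟩ | ⟨_, h₁, e⟩) (e' | _ | ⟨_, h₁', e'⟩ | ⟨_, h₁', e'⟩)
    any_goals first | exact (hl ‹_›).elim | exact (hr ‹_›).elim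
    · exact h.label_unique e e'
    · rfl
    · obtain ⟨rfl, rfl⟩ : _ ∧ _ := by simpa using h₁.symm.trans h₁'
      rw [h.label_unique e e']
    · obtain ⟨rfl, rfl⟩ : _ ∧ _ := by simpa using h₁.symm.trans h₁'
      rw [h.label_unique e e']
  · rintro u w Γ Δ (e | _ | ⟨ok, h₁, e⟩ | ⟨ok, h₁, e⟩) e'
    · rcases e' with e' | _ | ⟨_, h₁', e'⟩ | ⟨_, h₁', e'⟩
      any_goals first | exact (hl ‹_›).elim | exact (hr ‹_›).elim
      exact h.antisymm e e'
    · rfl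
    · rcases e' with e' | _ | ⟨_, h₁', e'⟩ | ⟨_, h₁', e'⟩
      any_goals first | exact (hl ‹_›).elim | exact (hr ‹_›).elim
      exact (hcycle ok h₁ h₁' e e').elim
    · rcases e' with e' | _ | ⟨_, h₁', e'⟩ | ⟨_, h₁', e'⟩
      any_goals first | exact (hl ‹_›).elim | exact (hr ‹_›).elim
      exact (hcycle ok h₁' h₁ e' e).elim
  · rintro u v w Γ Δ (e | _ | ⟨ok, h₁, e⟩ | @⟨x, A, _, Γ, ok, h₁, e⟩) e'
    · rcases e' with e' | _ | ⟨_, h₁', e'⟩ | @⟨x, A, _, Δ, ok', h₁', e'⟩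
      any_goals first | exact (hl ‹_›).elim | exact (hr ‹_›).elim
      · obtain ⟨Θ, e'', hΘ⟩ := h.trans e e'
        exact ⟨Θ, .old e'', hΘ⟩
      · obtain ⟨Θ, e'', hΘ⟩ := h.trans e e'
        exact ⟨_, .down ok' h₁' e'', by simpa using hΘ.append_right [A]⟩
    · exact ⟨Δ, e', .rfl⟩
    · rcases e' with e' | _ | ⟨_, h₁', e'⟩ | ⟨_, h₁', e'⟩
      any_goals first | exact (hl ‹_›).elim | exact (hr ‹_›).elim
      · obtain ⟨Θ, e'', hΘ⟩ := h.trans e e'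
        exact ⟨_, .up ok h₁ e'', hΘ.append_left [_]⟩
      · exact (hcycle ok h₁ h₁' e e').elim
    · rcases e' with e' | _ | @⟨y, B, _, Δ, _, h₁', e'⟩ | ⟨_, h₁', e'⟩
      any_goals first | exact (hl ‹_›).elim | exact (hr ‹_›).elim
      · exact ⟨_, .down ok h₁ e, by simpa using Refines.rfl⟩
      · obtain ⟨-, Ξ, e₀, hΞ⟩ := ok x A y B h₁' h₁
        obtain ⟨Θ₁, e₁, hΘ₁⟩ := h.trans e e₀
        obtain ⟨Θ₂, e₂, hΘ₂⟩ := h.trans e₁ e'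
        refine ⟨Θ₂, .old e₂, (hΘ₂.trans (hΘ₁.append_right Δ)).trans ?_⟩
        simpa using ((Refines.of_deriv_mul hΞ).append_left Γ).append_right Δ

/-- The network built from the first `n` requests. -/
def stage (req : ℕ → Request) : ℕ → LabelledGraph
  | 0 => fun _ _ _ => False
  | n + 1 => Extend (stage req n) n (req n)

theorem isNetwork_stage (req : ℕ → Request) (n : ℕ) :
    IsNetwork (Set.Iio n) (stage req n) := by
  induction n with
  | zero => constructor <;> simp [stage]
  | succ n ih => exact ih.extend (req n)

theorem stage_mono (req : ℕ → Request) : Monotone (stage req) :=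
  monotone_nat_of_le_succ fun _ _ _ _ e => .old e

/-- The union of all stages. -/
def limitGraph (req : ℕ → Request) : LabelledGraph := fun u w Γ => ∃ n, stage req n u w Γ

theorem isNetwork_limitGraph (req : ℕ → Request) : IsNetwork Set.univ (limitGraph req) := by
  have lift : ∀ {m n u w Γ}, m ≤ n → stage req m u w Γ → stage req n u w Γ :=
    fun hmn e => stage_mono req hmn _ _ _ e
  refine ⟨fun _ => trivial, fun _ => trivial,
    fun {u} _ => ⟨u + 1, (isNetwork_stage req (u + 1)).refl (Nat.lt_succ_self u)⟩, ?_, ?_, ?_⟩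
  · rintro u w Γ Δ ⟨m, e⟩ ⟨n, e'⟩
    exact (isNetwork_stage req (max m n)).label_unique
      (lift (le_max_left m n) e) (lift (le_max_right m n) e')
  · rintro u w Γ Δ ⟨m, e⟩ ⟨n, e'⟩
    exact (isNetwork_stage req (max m n)).antisymm
      (lift (le_max_left m n) e) (lift (le_max_right m n) e')
  · rintro u v w Γ Δ ⟨m, e⟩ ⟨n, e'⟩
    obtain ⟨Θ, e'', hΘ⟩ := (isNetwork_stage req (max m n)).trans
      (lift (le_max_left m n) e) (lift (le_max_right m n) e')
    exact ⟨Θ, ⟨_, e''⟩, hΘ⟩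

theorem stage_of_limitGraph {req : ℕ → Request} {n u w : ℕ} {Γ : List Fm}
    (hu : u < n) (hw : w < n) (h : limitGraph req u w Γ) : stage req n u w Γ := by
  obtain ⟨m, e⟩ := h
  induction m with
  | zero => exact e.elim
  | succ m ih =>
    rcases le_or_gt (m + 1) n with hmn | hmn
    · exact stage_mono req hmn _ _ _ e
    · rcases e with e | _ | _ | _
      · exact ih e
      all_goals omega

theorem exists_requests :
    ∃ req : ℕ → Request, ∀ r N, ∃ n, N < n ∧ req n = r := by
  obtain ⟨f, hf⟩ := exists_surjective_nat Request
  refine ⟨fun n => f n.unpair.1, fun r N => ?_⟩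
  obtain ⟨k, rfl⟩ := hf r
  exact ⟨Nat.pair k (N + 1), Nat.right_le_pair k (N + 1), by simp⟩

/-- A saturated network: every point has, for each formula, a free predecessor and a free
successor, and products on proper edges are witnessed. -/
structure IsSaturated (L : LabelledGraph) : Prop extends IsNetwork Set.univ L where
  exists_pred : ∀ x y A, ∃ z, L z x [A] ∧ ∀ Γ, L z y Γ → ∃ Δ, L x y Δ ∧ Γ = A :: Δ
  exists_succ : ∀ x y A, ∃ z, L y z [A] ∧ ∀ Γ, L x z Γ → ∃ Δ, L x y Δ ∧ Γ = Δ ++ [A]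
  exists_mid : ∀ {x y Γ A B}, x ≠ y → L x y Γ → Deriv Γ (Fm.mul A B) →
    ∃ z, L x z [A] ∧ L z y [B]

theorem exists_isSaturated : ∃ L, IsSaturated L := by
  obtain ⟨req, hreq⟩ := exists_requests
  refine ⟨limitGraph req, isNetwork_limitGraph req, ?_, ?_, ?_⟩
  · intro x y A
    obtain ⟨n, hn, hr⟩ := hreq (some (x, A), none) (max x y)
    have hx : x < n := by omega
    have hy : y < n := by omega
    have ok : (req n).Admissible (stage req n) := by simp [Request.Admissible, hr]
    refine ⟨n, ⟨n + 1, .up ok (by rw [hr]) ((isNetwork_stage req n).refl hx)⟩, fun Γ e => ?_⟩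
    rcases stage_of_limitGraph (Nat.lt_succ_self n) (Nat.lt_succ_of_lt hy) e with
      e' | _ | ⟨_, h₁, e'⟩ | _
    · exact (lt_irrefl n ((isNetwork_stage req n).left_mem e')).elim
    · omega
    · obtain ⟨rfl, rfl⟩ : _ ∧ _ := by simpa [hr] using h₁
      exact ⟨_, ⟨n, e'⟩, rfl⟩
    · omega
  · intro x y A
    obtain ⟨n, hn, hr⟩ := hreq (none, some (y, A)) (max x y)
    have hx : x < n := by omega
    have hy : y < n := by omega
    have ok : (req n).Admissible (stage req n) := by simp [Request.Admissible, hr]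
    refine ⟨n, ⟨n + 1, .down ok (by rw [hr]) ((isNetwork_stage req n).refl hy)⟩, fun Γ e => ?_⟩
    rcases stage_of_limitGraph (Nat.lt_succ_of_lt hx) (Nat.lt_succ_self n) e with
      e' | _ | _ | ⟨_, h₁, e'⟩
    · exact (lt_irrefl n ((isNetwork_stage req n).right_mem e')).elim
    · omega
    · omega
    · obtain ⟨rfl, rfl⟩ : _ ∧ _ := by simpa [hr] using h₁
      exact ⟨_, ⟨n, e'⟩, rfl⟩
  · intro x y Γ A B hne e hΓ
    obtain ⟨n, hn, hr⟩ := hreq (some (y, B), some (x, A)) (max x y)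
    have hx : x < n := by omega
    have hy : y < n := by omega
    have ok : (req n).Admissible (stage req n) := by
      intro x' A' y' B' h₁ h₂
      obtain ⟨rfl, rfl⟩ : _ ∧ _ := by simpa [hr] using h₁
      obtain ⟨rfl, rfl⟩ : _ ∧ _ := by simpa [hr] using h₂
      exact ⟨hne, Γ, stage_of_limitGraph hx hy e, hΓ⟩
    exact ⟨n, ⟨n + 1, .down ok (by rw [hr]) ((isNetwork_stage req n).refl hx)⟩,
      ⟨n + 1, .up ok (by rw [hr]) ((isNetwork_stage req n).refl hy)⟩⟩

/-- The square R-model given by a saturated network. -/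
def IsSaturated.model {L : LabelledGraph} (h : IsSaturated L) : SqModel ℕ where
  v A := {p | ∃ Γ, L p.1 p.2 Γ ∧ Deriv Γ A}
  v_mul A B := by
    ext ⟨x, y⟩
    constructor
    · rintro ⟨Γ, e, hΓ⟩
      by_cases hxy : x = y
      · obtain rfl : x = y := hxy
        obtain rfl := h.label_unique e (h.refl trivial)
        exact ⟨x, ⟨[], e, hΓ.of_nil_mul.1⟩, ⟨[], e, hΓ.of_nil_mul.2⟩⟩
      · obtain ⟨z, e₁, e₂⟩ := h.exists_mid hxy e hΓ
        exact ⟨z, ⟨_, e₁, .id A⟩, ⟨_, e₂, .id B⟩⟩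
    · rintro ⟨z, ⟨Γ, e₁, hΓ⟩, ⟨Δ, e₂, hΔ⟩⟩
      obtain ⟨Θ, e, hΘ⟩ := h.trans e₁ e₂
      exact ⟨Θ, e, hΘ.deriv (.mulR hΓ hΔ)⟩
  v_ldiv A B := by
    ext ⟨y, z⟩
    constructor
    · rintro ⟨Γ, e, hΓ⟩ x ⟨Δ, e', hΔ⟩
      obtain ⟨Θ, e'', hΘ⟩ := h.trans e' e
      exact ⟨Θ, e'', hΘ.deriv (hΔ.ldiv_app hΓ)⟩
    · intro hyz
      obtain ⟨x, e, hx⟩ := h.exists_pred y z A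
      obtain ⟨Γ, e', hΓ⟩ := hyz x ⟨_, e, .id A⟩
      obtain ⟨Δ, e'', rfl⟩ := hx Γ e'
      exact ⟨Δ, e'', .ldivR hΓ⟩
  v_rdiv B A := by
    ext ⟨x, y⟩
    constructor
    · rintro ⟨Γ, e, hΓ⟩ z ⟨Δ, e', hΔ⟩
      obtain ⟨Θ, e'', hΘ⟩ := h.trans e e'
      exact ⟨Θ, e'', hΘ.deriv (hΓ.rdiv_app hΔ)⟩
    · intro hxy
      obtain ⟨z, e, hz⟩ := h.exists_succ x y A
      obtain ⟨Γ, e', hΓ⟩ := hxy z ⟨_, e, .id A⟩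
      obtain ⟨Δ, e'', rfl⟩ := hz Γ e'
      exact ⟨Δ, e'', .rdivR hΓ⟩
  v_inter A B := by
    ext ⟨x, y⟩
    constructor
    · rintro ⟨Γ, e, hΓ⟩
      exact ⟨⟨Γ, e, hΓ.inter_left⟩, ⟨Γ, e, hΓ.inter_right⟩⟩
    · rintro ⟨⟨Γ, e, hΓ⟩, ⟨Δ, e', hΔ⟩⟩
      obtain rfl := h.label_unique e e'
      exact ⟨Γ, e, .andR hΓ hΔ⟩

theorem SqModel.seqTrue_ldiv {W : Type} (M : SqModel W) {A B : Fm} {Γ : List Fm}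
    (h : M.seqTrue (A :: Γ, B)) : M.seqTrue (Γ, Fm.ldiv A B) := by
  rintro ⟨y, z⟩ hyz
  rw [M.v_ldiv]
  exact fun x hx => h ⟨y, hx, hyz⟩

/-- Mikulás' theorem: if a sequent in the language of `\, /, ·, ∧` is true in every
square R-model, then it is derivable in `L^Λ(∧)`. -/
theorem mikulas_weak_completeness (P : List Fm) (B : Fm)
    (h : ∀ (W : Type) [Nonempty W] (M : SqModel W), M.seqTrue (P, B)) :
    Deriv P B := by
  induction P generalizing B with
  | nil =>
    obtain ⟨L, hL⟩ := exists_isSaturated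
    obtain ⟨Γ, e, hΓ⟩ := h ℕ hL.model (show ((0, 0) : ℕ × ℕ) ∈ diag from rfl)
    obtain rfl := hL.label_unique e (hL.refl trivial)
    exact hΓ
  | cons A P ih =>
    exact (Deriv.id A).ldiv_app (ih _ fun W _ M => M.seqTrue_ldiv (h W M))
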